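/- Let E ⊆ ℝ^N be a convex body of unit volume whose diameter exceeds N𝒟, where 𝒟 = (2N/(N−1))^{N−1} ω_N^{(N−1)/N} ω_{N−1}^{−1}. Then P(E) ≥ 2N ω_N^{1/N}, i.e. the isoperimetric deficit δ(E) = (P(E) − Nω_N^{1/N})/(Nω_N^{1/N}) is at least 1. -/

import Mathlib

open MeasureTheory Metric Set ENNReal

noncomputable section

abbrev En (N : ℕ) := EuclideanSpace ℝ (Fin N)

/-- The volume of the unit ball in `ℝ^N`. -/
def omegaB (N : ℕ) : ℝ := (volume (Metric.ball (0 : En N) 1)).toReal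

/-- The divergence of a vector field on `ℝ^N`. -/
def divg {N : ℕ} (φ : En N → En N) (x : En N) : ℝ :=
  ∑ i, fderiv ℝ φ x (EuclideanSpace.single i (1 : ℝ)) i

/-- The set of candidate values in the sup defining the distributional perimeter of `E`. -/
def perSet {N : ℕ} (E : Set (En N)) : Set ℝ :=
  {p | ∃ φ : En N → En N, ContDiff ℝ 1 φ ∧ HasCompactSupport φ ∧
    (∀ x, ‖φ x‖ ≤ 1) ∧ p = ∫ x in E, divg φ x}

/-- The distributional (De Giorgi) perimeter of `E`. -/
def perimeter {N : ℕ} (E : Set (En N)) : ℝ := sSup (perSet E)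

/-- `E` has finite perimeter. -/
def HasFinitePerimeter {N : ℕ} (E : Set (En N)) : Prop := BddAbove (perSet E)

/-- The essential diameter of `E`. -/
def essDiam {N : ℕ} (E : Set (En N)) : ℝ≥0∞ :=
  sInf {d : ℝ≥0∞ |
    (volume.prod volume) {p : En N × En N | p.1 ∈ E ∧ p.2 ∈ E ∧ d < edist p.1 p.2} = 0}

/-- The barycenter of `E`. -/
def bary {N : ℕ} (E : Set (En N)) : En N := ((volume E).toReal)⁻¹ • ∫ x in E, x

/-- The radius of the ball having the same volume as `E`. -/
def ballRad {N : ℕ} (E : Set (En N)) : ℝ := ((volume E).toReal / omegaB N) ^ (1 / (N : ℝ))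

/-- The barycentric asymmetry `λ₀(E)`. -/
def lam0 {N : ℕ} (E : Set (En N)) : ℝ :=
  (volume (symmDiff E (Metric.ball (bary E) (ballRad E)))).toReal / (volume E).toReal

/-- The Fraenkel asymmetry `λ(E)`. -/
def fraenkel {N : ℕ} (E : Set (En N)) : ℝ :=
  ⨅ y : En N, (volume (symmDiff E (Metric.ball y (ballRad E)))).toReal / (volume E).toReal

/-- The isoperimetric deficit `δ(E)`. -/
def deficit {N : ℕ} (E : Set (En N)) : ℝ :=
  (perimeter E - perimeter (Metric.ball (0 : En N) (ballRad E))) /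
    perimeter (Metric.ball (0 : En N) (ballRad E))

/-- Measure-theoretic connectedness. -/
def MConnected {N : ℕ} (E : Set (En N)) : Prop :=
  ∀ F : Set (En N), MeasurableSet F → F ⊆ E → 0 < volume F → volume F < volume E →
    perimeter E < perimeter F + perimeter (E \ F)

/-- The one-dimensional Brunn–Minkowski inequality. -/
theorem volume_add_volume_le_of_add_mem {A B C : Set ℝ} (hA : MeasurableSet A)
    (hB : MeasurableSet B) (hAn : A.Nonempty) (hBn : B.Nonempty)
    (h : ∀ x ∈ A, ∀ y ∈ B, x + y ∈ C) : volume A + volume B ≤ volume C := by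
  obtain ⟨a₀, ha₀⟩ := hAn
  obtain ⟨b₀, hb₀⟩ := hBn
  have compact_case : ∀ K ⊆ A, ∀ L ⊆ B, IsCompact K → IsCompact L → K.Nonempty → L.Nonempty →
      volume K + volume L ≤ volume C := by
    intro K hKA L hLB hK hL hKn hLn
    obtain ⟨p, hpK, hp⟩ := hK.exists_isGreatest hKn
    obtain ⟨q, hqL, hq⟩ := hL.exists_isLeast hLn
    have h1 : volume ((fun x => -q + x) ⁻¹' K) = volume K := measure_preimage_add _ _ _
    have h2 : volume ((fun x => -p + x) ⁻¹' L) = volume L := measure_preimage_add _ _ _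
    rw [← h1, ← h2, ← measure_union₀]
    · refine measure_mono ?_
      rintro x (hx | hx)
      · have := h _ (hKA hx) _ (hLB hqL)
        simpa using this
      · have := h _ (hKA hpK) _ (hLB hx)
        simpa using this
    · exact ((measurable_const_add _) hL.measurableSet).nullMeasurableSet
    · refine measure_mono_null (t := {p + q}) ?_ (by simp)
      rintro x ⟨hx, hx'⟩
      have e1 := hp hx
      have e2 := hq hx'
      simp only [mem_singleton_iff]
      linarith
  rcases eq_or_ne (volume C) ∞ with hC | hC
  · simp [hC]
  have hAf : volume A ≠ ∞ := by
    refine ne_top_of_le_ne_top hC ?_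
    have h1 : volume ((fun x => -b₀ + x) ⁻¹' A) = volume A := measure_preimage_add _ _ _
    rw [← h1]
    refine measure_mono fun x hx => ?_
    have := h _ hx _ hb₀
    simpa using this
  have hBf : volume B ≠ ∞ := by
    refine ne_top_of_le_ne_top hC ?_
    have h1 : volume ((fun x => -a₀ + x) ⁻¹' B) = volume B := measure_preimage_add _ _ _
    rw [← h1]
    refine measure_mono fun x hx => ?_
    have := h _ ha₀ _ hx
    simpa using this
  refine ENNReal.le_of_forall_pos_le_add fun ε hε _ => ?_
  have hε2 : (ε / 2 : ℝ≥0∞) ≠ 0 := by simp [hε.ne']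
  obtain ⟨K, hKA, hK, hKε⟩ := hA.exists_isCompact_lt_add hAf hε2
  obtain ⟨L, hLB, hL, hLε⟩ := hB.exists_isCompact_lt_add hBf hε2
  have key := compact_case (insert a₀ K) (insert_subset ha₀ hKA) (insert b₀ L)
    (insert_subset hb₀ hLB) (hK.insert _) (hL.insert _) (insert_nonempty _ _) (insert_nonempty _ _)
  calc volume A + volume B ≤ (volume K + ε / 2) + (volume L + ε / 2) := by gcongr
    _ = (volume K + volume L) + ε := by rw [add_add_add_comm, ENNReal.add_halves]
    _ ≤ (volume (insert a₀ K) + volume (insert b₀ L)) + ε := by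
        gcongr <;> exact subset_insert _ _
    _ ≤ volume C + ε := by gcongr

theorem lintegral_add_lintegral_le_of_min_le {f g h : ℝ → ℝ} (hf : Measurable f)
    (hg : Measurable g) (hh : Measurable h) {a b : ℝ} (ha : 0 < a) (hb : 0 < b)
    (hf0 : ∀ x, 0 ≤ f x) (hg0 : ∀ x, 0 ≤ g x) (hh0 : ∀ x, 0 ≤ h x)
    (hf1 : ∀ x, f x ≤ 1) (hg1 : ∀ x, g x ≤ 1)
    (hfs : ∀ s < 1, ∃ x, s < f x) (hgs : ∀ s < 1, ∃ x, s < g x)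
    (H : ∀ x y, min (f x) (g y) ≤ h (a * x + b * y)) :
    ENNReal.ofReal a * (∫⁻ x, ENNReal.ofReal (f x))
        + ENNReal.ofReal b * (∫⁻ x, ENNReal.ofReal (g x))
      ≤ ∫⁻ x, ENNReal.ofReal (h x) := by
  rw [lintegral_eq_lintegral_meas_lt volume (.of_forall hf0) hf.aemeasurable,
    lintegral_eq_lintegral_meas_lt volume (.of_forall hg0) hg.aemeasurable,
    lintegral_eq_lintegral_meas_lt volume (.of_forall hh0) hh.aemeasurable]
  have anti : ∀ k : ℝ → ℝ, Measurable fun t => volume {x | t < k x} := fun k =>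
    Antitone.measurable fun s t hst => measure_mono fun x hx => lt_of_le_of_lt hst hx
  rw [← lintegral_const_mul _ (anti f), ← lintegral_const_mul _ (anti g),
    ← lintegral_add_left ((anti f).const_mul _)]
  refine lintegral_mono fun t => ?_
  rcases le_or_gt 1 t with ht | ht
  · have e1 : {x | t < f x} = ∅ := by
      ext x; simpa using (hf1 x).trans ht
    have e2 : {x | t < g x} = ∅ := by
      ext x; simpa using (hg1 x).trans ht
    simp [e1, e2]
  · have s1 := Real.volume_preimage_mul_left (inv_ne_zero ha.ne') {x | t < f x}
    have s2 := Real.volume_preimage_mul_left (inv_ne_zero hb.ne') {x | t < g x}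
    rw [inv_inv, abs_of_pos ha] at s1
    rw [inv_inv, abs_of_pos hb] at s2
    simp only [← s1, ← s2]
    apply volume_add_volume_le_of_add_mem
    · exact (measurable_const_mul _) (measurableSet_lt measurable_const hf)
    · exact (measurable_const_mul _) (measurableSet_lt measurable_const hg)
    · obtain ⟨x, hx⟩ := hfs t ht
      exact ⟨a * x, by simpa [ha.ne'] using hx⟩
    · obtain ⟨x, hx⟩ := hgs t ht
      exact ⟨b * x, by simpa [hb.ne'] using hx⟩
    · intro x hx y hy
      have := H (a⁻¹ * x) (b⁻¹ * y)
      rw [mul_inv_cancel_left₀ ha.ne', mul_inv_cancel_left₀ hb.ne'] at this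
      exact (lt_min hx hy).trans_le this

theorem rpow_mul_rpow_le_weighted_add {a b : ℝ} (ha : 0 < a) (hb : 0 < b) (hab : a + b = 1)
    (p q : ℝ≥0∞) :
    p ^ a * q ^ b ≤ ENNReal.ofReal a * p + ENNReal.ofReal b * q := by
  rcases eq_or_ne p ∞ with rfl | hp
  · simp [ENNReal.mul_top, ha]
  rcases eq_or_ne q ∞ with rfl | hq
  · simp [ENNReal.mul_top, hb]
  lift p to NNReal using hp
  lift q to NNReal using hq
  have := NNReal.geom_mean_le_arith_mean2_weighted a.toNNReal b.toNNReal p q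
    (by rw [← Real.toNNReal_add ha.le hb.le, hab, Real.toNNReal_one])
  rw [Real.coe_toNNReal _ ha.le, Real.coe_toNNReal _ hb.le] at this
  rw [← ENNReal.coe_rpow_of_nonneg _ ha.le, ← ENNReal.coe_rpow_of_nonneg _ hb.le]
  unfold ENNReal.ofReal
  exact_mod_cast this

/-- The one-dimensional Prékopa–Leindler inequality for bounded functions. -/
theorem prekopa_leindler_real {F G H : ℝ → ℝ≥0∞} (hF : Measurable F) (hG : Measurable G)
    (hH : Measurable H) {a b : ℝ} (ha : 0 < a) (hb : 0 < b) (hab : a + b = 1)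
    {M : ℝ≥0∞} (hM : M ≠ ∞) (hFM : ∀ x, F x ≤ M) (hGM : ∀ x, G x ≤ M)
    (h : ∀ x y, F x ^ a * G y ^ b ≤ H (a * x + b * y)) :
    (∫⁻ x, F x) ^ a * (∫⁻ x, G x) ^ b ≤ ∫⁻ x, H x := by
  set α := ⨆ x, F x with hα
  set β := ⨆ x, G x with hβ
  have hαt : α ≠ ∞ := ne_top_of_le_ne_top hM (iSup_le hFM)
  have hβt : β ≠ ∞ := ne_top_of_le_ne_top hM (iSup_le hGM)
  have hFα : ∀ x, F x ≤ α := le_iSup F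
  have hGβ : ∀ x, G x ≤ β := le_iSup G
  rcases eq_or_ne α 0 with h0 | hα0
  · have : ∀ x, F x = 0 := fun x => by simpa [h0] using hFα x
    simp [this, ha]
  rcases eq_or_ne β 0 with h0 | hβ0
  · have : ∀ x, G x = 0 := fun x => by simpa [h0] using hGβ x
    simp [this, hb]
  set γ := α ^ a * β ^ b with hγ
  have hγ0 : γ ≠ 0 := by
    simp [hγ, ENNReal.rpow_eq_zero_iff, hα0, hβ0, hαt, hβt]
  have hγt : γ ≠ ∞ :=
    ENNReal.mul_ne_top (ENNReal.rpow_ne_top_of_nonneg ha.le hαt)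
      (ENNReal.rpow_ne_top_of_nonneg hb.le hβt)
  have hf1 : ∀ x, F x / α ≤ 1 := fun x => ENNReal.div_le_of_le_mul (by simpa using hFα x)
  have hg1 : ∀ x, G x / β ≤ 1 := fun x => ENNReal.div_le_of_le_mul (by simpa using hGβ x)
  have hft : ∀ x, F x / α ≠ ∞ := fun x => ne_top_of_le_ne_top one_ne_top (hf1 x)
  have hgt : ∀ x, G x / β ≠ ∞ := fun x => ne_top_of_le_ne_top one_ne_top (hg1 x)
  have hht : ∀ x, min 1 (H x / γ) ≠ ∞ := fun x => ne_top_of_le_ne_top one_ne_top (min_le_left _ _)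
  have sup_one : ∀ (k : ℝ → ℝ≥0∞), (⨆ x, k x) ≠ 0 → (⨆ x, k x) ≠ ∞ → (∀ x, k x / (⨆ x, k x) ≠ ∞) →
      ∀ s < (1 : ℝ), ∃ x, s < (k x / (⨆ x, k x)).toReal := by
    intro k h0 ht hkt s hs
    rcases lt_or_ge s 0 with hs0 | hs0
    · exact ⟨0, hs0.trans_le ENNReal.toReal_nonneg⟩
    · have : ENNReal.ofReal s * (⨆ x, k x) < ⨆ x, k x := by
        conv_rhs => rw [← one_mul (⨆ x, k x)]
        exact (ENNReal.mul_lt_mul_iff_left h0 ht).2 (by simpa using hs)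
      obtain ⟨x, hx⟩ := lt_iSup_iff.1 this
      refine ⟨x, (ENNReal.ofReal_lt_iff_lt_toReal hs0 (hkt x)).1 ?_⟩
      exact (ENNReal.lt_div_iff_mul_lt (Or.inl h0) (Or.inl ht)).2 hx
  have key := lintegral_add_lintegral_le_of_min_le
    (f := fun x => (F x / α).toReal) (g := fun x => (G x / β).toReal)
    (h := fun x => (min 1 (H x / γ)).toReal)
    (hF.div_const _).ennreal_toReal (hG.div_const _).ennreal_toReal
    (measurable_const.min (hH.div_const _)).ennreal_toReal ha hb
    (fun _ => ENNReal.toReal_nonneg) (fun _ => ENNReal.toReal_nonneg)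
    (fun _ => ENNReal.toReal_nonneg)
    (fun x => by simpa using ENNReal.toReal_mono one_ne_top (hf1 x))
    (fun x => by simpa using ENNReal.toReal_mono one_ne_top (hg1 x))
    (sup_one F hα0 hαt hft) (sup_one G hβ0 hβt hgt) (by
      intro x y
      rw [← ENNReal.toReal_min (hft x) (hgt y)]
      refine ENNReal.toReal_mono (hht _) (le_min ((min_le_left _ _).trans (hf1 x)) ?_)
      have hm : ∀ m : ℝ≥0∞, m = m ^ a * m ^ b := fun m => by
        rw [← ENNReal.rpow_add_of_nonneg _ _ ha.le hb.le, hab, ENNReal.rpow_one]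
      calc min (F x / α) (G y / β)
          = (min (F x / α) (G y / β)) ^ a * (min (F x / α) (G y / β)) ^ b := hm _
        _ ≤ (F x / α) ^ a * (G y / β) ^ b := by
            gcongr
            · exact min_le_left _ _
            · exact min_le_right _ _
        _ = (F x ^ a * G y ^ b) / γ := by
            rw [ENNReal.div_rpow_of_nonneg _ _ ha.le, ENNReal.div_rpow_of_nonneg _ _ hb.le, hγ]
            simp only [div_eq_mul_inv]
            rw [ENNReal.mul_inv (Or.inr (ENNReal.rpow_ne_top_of_nonneg hb.le hβt))
              (Or.inl (ENNReal.rpow_ne_top_of_nonneg ha.le hαt))]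
            ring
        _ ≤ H (a * x + b * y) / γ := by gcongr; exact h x y)
  simp only [ENNReal.ofReal_toReal (hft _), ENNReal.ofReal_toReal (hgt _),
    ENNReal.ofReal_toReal (hht _)] at key
  have key2 := (rpow_mul_rpow_le_weighted_add ha hb hab _ _).trans key
  have key3 : ∫⁻ x, min 1 (H x / γ) ≤ (∫⁻ x, H x) / γ := by
    simp only [div_eq_mul_inv]
    rw [← lintegral_mul_const _ hH]
    exact lintegral_mono fun x => min_le_right _ _
  have key4 := key2.trans key3
  simp only [div_eq_mul_inv] at key4
  rw [lintegral_mul_const _ hF, lintegral_mul_const _ hG] at key4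
  simp only [← div_eq_mul_inv] at key4
  rw [ENNReal.div_rpow_of_nonneg _ _ ha.le, ENNReal.div_rpow_of_nonneg _ _ hb.le] at key4
  have e : (∫⁻ x, F x) ^ a / α ^ a * ((∫⁻ x, G x) ^ b / β ^ b)
      = ((∫⁻ x, F x) ^ a * (∫⁻ x, G x) ^ b) / γ := by
    simp only [div_eq_mul_inv, hγ]
    rw [ENNReal.mul_inv (Or.inr (ENNReal.rpow_ne_top_of_nonneg hb.le hβt))
      (Or.inl (ENNReal.rpow_ne_top_of_nonneg ha.le hαt))]
    ring
  rw [e] at key4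
  simpa only [ENNReal.div_mul_cancel hγ0 hγt] using mul_le_mul_left key4 γ

/-- The multiplicative Brunn–Minkowski inequality for bounded sets in `Fin n → ℝ`. -/
theorem brunn_minkowski_pi {a b : ℝ} (ha : 0 < a) (hb : 0 < b) (hab : a + b = 1) (R : ℝ) (n : ℕ) :
    ∀ {A B C : Set (Fin n → ℝ)}, MeasurableSet A → MeasurableSet B → MeasurableSet C →
      A ⊆ Icc (fun _ => -R) (fun _ => R) → B ⊆ Icc (fun _ => -R) (fun _ => R) →
      (∀ x ∈ A, ∀ y ∈ B, a • x + b • y ∈ C) → volume A ^ a * volume B ^ b ≤ volume C := by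
  induction n with
  | zero =>
    intro A B C hA hB hC _ _ h
    rcases A.eq_empty_or_nonempty with rfl | ⟨x, hx⟩
    · simp [ha]
    rcases B.eq_empty_or_nonempty with rfl | ⟨y, hy⟩
    · simp [hb]
    have hC1 : C = univ := Subsingleton.eq_univ_of_nonempty ⟨_, h x hx y hy⟩
    have hA1 : A = univ := Subsingleton.eq_univ_of_nonempty ⟨x, hx⟩
    have hB1 : B = univ := Subsingleton.eq_univ_of_nonempty ⟨y, hy⟩
    simp [hC1, hA1, hB1, volume_pi]
  | succ n ih =>
    intro A B C hA hB hC hAR hBR h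
    let e := MeasurableEquiv.piFinSuccAbove (fun _ : Fin (n + 1) => ℝ) 0
    have he : MeasurePreserving e.symm :=
      (volume_preserving_piFinSuccAbove (fun _ : Fin (n + 1) => ℝ) 0).symm _
    have hes : ∀ p, e.symm p = Fin.insertNth 0 p.1 p.2 := fun _ => rfl
    have fubini : ∀ S : Set (Fin (n + 1) → ℝ), MeasurableSet S →
        volume S = ∫⁻ t, volume (Prod.mk t ⁻¹' (e.symm ⁻¹' S)) := by
      intro S hS
      rw [← he.measure_preimage hS.nullMeasurableSet, Measure.volume_eq_prod,
        Measure.prod_apply (e.symm.measurable hS)]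
    have mslice : ∀ S : Set (Fin (n + 1) → ℝ), MeasurableSet S →
        Measurable fun t => volume (Prod.mk t ⁻¹' (e.symm ⁻¹' S)) := fun S hS =>
      measurable_measure_prodMk_left (e.symm.measurable hS)
    have bslice : ∀ S : Set (Fin (n + 1) → ℝ), S ⊆ Icc (fun _ => -R) (fun _ => R) → ∀ t,
        Prod.mk t ⁻¹' (e.symm ⁻¹' S) ⊆ Icc (fun _ => -R) (fun _ => R) := by
      intro S hS t y hy
      have := hS hy
      refine ⟨fun i => ?_, fun i => ?_⟩
      · simpa [hes] using this.1 i.succ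
      · simpa [hes] using this.2 i.succ
    rw [fubini A hA, fubini B hB, fubini C hC]
    refine prekopa_leindler_real (mslice A hA) (mslice B hB) (mslice C hC) ha hb hab
      (M := volume (Icc (fun _ : Fin n => -R) (fun _ => R))) isCompact_Icc.measure_lt_top.ne
      (fun t => measure_mono (bslice A hAR t)) (fun t => measure_mono (bslice B hBR t)) ?_
    intro s t
    refine ih (measurable_prodMk_left (e.symm.measurable hA))
      (measurable_prodMk_left (e.symm.measurable hB))
      (measurable_prodMk_left (e.symm.measurable hC)) (bslice A hAR s) (bslice B hBR t) ?_
    intro x hx y hy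
    have := h _ hx _ hy
    simp only [mem_preimage, hes] at this ⊢
    convert this using 1
    ext i
    refine Fin.cases ?_ (fun j => ?_) i <;> simp

theorem brunn_minkowski {n : ℕ} {a b : ℝ} (ha : 0 < a) (hb : 0 < b) (hab : a + b = 1)
    {A B C : Set (En n)} (hA : MeasurableSet A) (hB : MeasurableSet B) (hC : MeasurableSet C)
    (hAb : Bornology.IsBounded A) (hBb : Bornology.IsBounded B)
    (h : ∀ x ∈ A, ∀ y ∈ B, a • x + b • y ∈ C) : volume A ^ a * volume B ^ b ≤ volume C := by
  have hT := PiLp.volume_preserving_toLp (Fin n)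
  obtain ⟨R, hR⟩ := (hAb.union hBb).exists_norm_le
  have hbox : ∀ S : Set (En n), S ⊆ A ∪ B →
      WithLp.toLp 2 ⁻¹' S ⊆ Icc (fun _ : Fin n => -R) (fun _ => R) := by
    intro S hS y hy
    have h1 := hR _ (hS hy)
    have h2 : ∀ i, |y i| ≤ R := fun i => by
      have := PiLp.norm_apply_le (WithLp.toLp 2 y : En n) i
      exact this.trans h1
    exact ⟨fun i => (abs_le.1 (h2 i)).1, fun i => (abs_le.1 (h2 i)).2⟩
  rw [← hT.measure_preimage hA.nullMeasurableSet, ← hT.measure_preimage hB.nullMeasurableSet,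
    ← hT.measure_preimage hC.nullMeasurableSet]
  refine brunn_minkowski_pi ha hb hab R n (hT.measurable hA) (hT.measurable hB) (hT.measurable hC)
    (hbox A subset_union_left) (hbox B subset_union_right) ?_
  intro x hx y hy
  exact h _ hx _ hy

theorem exists_measurePreserving_slicing {n : ℕ} {u : En (n + 1)} (hu : ‖u‖ = 1) :
    ∃ J : En n →ₗᵢ[ℝ] En (n + 1), (∀ y, inner ℝ u (J y) = 0) ∧
      (∀ x, ∃ p : ℝ × En n, p.1 • u + J p.2 = x) ∧
      MeasurePreserving (fun p : ℝ × En n => p.1 • u + J p.2) := by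
  obtain ⟨b, hb⟩ := Orthonormal.exists_orthonormalBasis_extension_of_card_eq (𝕜 := ℝ)
    (E := En (n + 1)) (ι := Fin (n + 1)) (by simp) (v := fun _ => u) (s := {0}) (by
      refine ⟨fun i => by simpa using hu, fun i j hij => ?_⟩
      exact absurd (Subsingleton.elim i j) hij)
  have hb0 : b 0 = u := hb 0 rfl
  let J₀ : En n →ₗᵢ[ℝ] En (n + 1) :=
    { toFun := fun y => WithLp.toLp 2 (Fin.cons 0 y.ofLp)
      map_add' := fun x y => by
        ext i; refine Fin.cases ?_ (fun j => ?_) i <;> simp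
      map_smul' := fun c x => by
        ext i; refine Fin.cases ?_ (fun j => ?_) i <;> simp
      norm_map' := fun y => by
        simp [EuclideanSpace.norm_eq, Fin.sum_univ_succ] }
  let J : En n →ₗᵢ[ℝ] En (n + 1) := b.repr.symm.toLinearIsometry.comp J₀
  have hJ : ∀ p : ℝ × En n,
      p.1 • u + J p.2 = b.repr.symm (WithLp.toLp 2 (Fin.cons p.1 p.2.ofLp)) := by
    intro p
    have e : (WithLp.toLp 2 (Fin.cons p.1 p.2.ofLp) : En (n + 1))
        = p.1 • EuclideanSpace.single 0 1 + J₀ p.2 := by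
      ext i
      refine Fin.cases ?_ (fun j => ?_) i
      · simp [J₀]
      · simp [J₀]
    rw [e, map_add, map_smul, b.repr_symm_single, hb0]
    rfl
  refine ⟨J, fun y => ?_, fun x => ?_, ?_⟩
  · rw [← hb0, ← b.repr_apply_apply]
    simp [J, J₀]
  · refine ⟨(b.repr x 0, WithLp.toLp 2 fun i => b.repr x i.succ), ?_⟩
    rw [hJ, LinearIsometryEquiv.symm_apply_eq]
    ext i
    refine Fin.cases ?_ (fun j => ?_) i <;> simp
  · simp only [hJ]
    have h1 := (MeasurePreserving.id (volume : Measure ℝ)).prod (PiLp.volume_preserving_ofLp (Fin n))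
    have h2 := (volume_preserving_piFinSuccAbove (fun _ : Fin (n + 1) => ℝ) 0).symm _
    have h3 := PiLp.volume_preserving_toLp (Fin (n + 1))
    have h4 := b.measurePreserving_repr_symm
    have e : (fun p : ℝ × En n => b.repr.symm (WithLp.toLp 2 (Fin.cons p.1 p.2.ofLp)))
        = fun p => b.repr.symm (WithLp.toLp 2 (Fin.insertNth 0 p.1 p.2.ofLp)) := by
      funext p
      rw [Fin.insertNth_zero']
    rw [e]
    exact h4.comp (h3.comp (h2.comp h1))

theorem volume_eq_lintegral_slice {n : ℕ} {u : En (n + 1)} {J : En n →ₗᵢ[ℝ] En (n + 1)}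
    (hJ : MeasurePreserving (fun p : ℝ × En n => p.1 • u + J p.2)) {S : Set (En (n + 1))}
    (hS : MeasurableSet S) :
    volume S = ∫⁻ t : ℝ, volume {y : En n | t • u + J y ∈ S} := by
  rw [← hJ.measure_preimage hS.nullMeasurableSet, Measure.volume_eq_prod,
    Measure.prod_apply (hJ.measurable hS)]
  rfl

theorem lintegral_pow_rising {a b : ℝ} (hab : a < b) (n : ℕ) :
    ∫⁻ s in Ioc a b, ENNReal.ofReal (((s - a) / (b - a)) ^ n)
      = ENNReal.ofReal ((b - a) / (n + 1)) := by
  have hba : b - a ≠ 0 := (sub_pos.2 hab).ne'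
  rw [← ofReal_integral_eq_lintegral_ofReal, ← intervalIntegral.integral_of_le hab.le]
  · congr 1
    simp only [div_pow]
    rw [intervalIntegral.integral_div,
      intervalIntegral.integral_comp_sub_right (fun x => x ^ n), integral_pow]
    field_simp
    simp [pow_succ']
  · exact (Continuous.integrableOn_Icc (by fun_prop)).mono_set Ioc_subset_Icc_self
  · refine (ae_restrict_iff' measurableSet_Ioc).2 (.of_forall fun s hs => ?_)
    exact pow_nonneg (div_nonneg (sub_nonneg.2 hs.1.le) (sub_nonneg.2 hab.le)) n

theorem lintegral_pow_falling {a b : ℝ} (hab : a < b) (n : ℕ) :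
    ∫⁻ s in Ioc a b, ENNReal.ofReal (((b - s) / (b - a)) ^ n)
      = ENNReal.ofReal ((b - a) / (n + 1)) := by
  have hba : b - a ≠ 0 := (sub_pos.2 hab).ne'
  rw [← ofReal_integral_eq_lintegral_ofReal, ← intervalIntegral.integral_of_le hab.le]
  · congr 1
    simp only [div_pow]
    rw [intervalIntegral.integral_div,
      intervalIntegral.integral_comp_sub_left (fun x => x ^ n), integral_pow]
    field_simp
    simp [pow_succ']
  · exact (Continuous.integrableOn_Icc (by fun_prop)).mono_set Ioc_subset_Icc_self
  · refine (ae_restrict_iff' measurableSet_Ioc).2 (.of_forall fun s hs => ?_)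
    exact pow_nonneg (div_nonneg (sub_nonneg.2 hs.2) (sub_nonneg.2 hab.le)) n

/-- Slices of a convex set grow at least like those of a cone with a given apex. -/
theorem volume_slice_cone_le {n : ℕ} {u : En (n + 1)} {J : En n →ₗᵢ[ℝ] En (n + 1)}
    {E : Set (En (n + 1))} (hE : Convex ℝ E) {t₀ : ℝ} {y₀ : En n} (h₀ : t₀ • u + J y₀ ∈ E)
    {t c : ℝ} (hc0 : 0 ≤ c) (hc1 : c ≤ 1) :
    ENNReal.ofReal (c ^ n) * volume {y : En n | t • u + J y ∈ E}
      ≤ volume {y : En n | (t₀ + c * (t - t₀)) • u + J y ∈ E} := by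
  have := Measure.addHaar_image_homothety (volume : Measure (En n)) y₀ c
    {y : En n | t • u + J y ∈ E}
  rw [finrank_euclideanSpace_fin, abs_of_nonneg (pow_nonneg hc0 n)] at this
  rw [← this]
  refine measure_mono ?_
  rintro _ ⟨y, hy, rfl⟩
  have h1 := hE h₀ hy (sub_nonneg.2 hc1) hc0 (by ring)
  simp only [mem_ofPred_eq, AffineMap.homothety_apply, vsub_eq_sub, vadd_eq_add, map_add,
    map_smul, map_sub]
  convert h1 using 1
  module

theorem volume_slice_le {n : ℕ} {u : En (n + 1)} {J : En n →ₗᵢ[ℝ] En (n + 1)} (hu : ‖u‖ = 1)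
    (hJu : ∀ y, inner ℝ u (J y) = 0) (hJs : ∀ x, ∃ p : ℝ × En n, p.1 • u + J p.2 = x)
    (hJ : MeasurePreserving (fun p : ℝ × En n => p.1 • u + J p.2))
    {E : Set (En (n + 1))} (hE : Convex ℝ E) (hEc : IsCompact E) {x : En (n + 1)}
    (hx : x ∈ E) (hxu : x + Metric.diam E • u ∈ E) (t : ℝ) :
    ENNReal.ofReal (Metric.diam E / (n + 1)) * volume {y : En n | t • u + J y ∈ E}
      ≤ volume E := by
  set D := Metric.diam E with hD
  obtain ⟨⟨t₀, y₀⟩, rfl⟩ := hJs x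
  simp only at hx hxu
  rcases ({y : En n | t • u + J y ∈ E}).eq_empty_or_nonempty with h0 | ⟨y, hy⟩
  · simp [h0]
  have hxu' : (t₀ + D) • u + J y₀ ∈ E := by convert hxu using 1; module
  have huu : inner ℝ u u = (1 : ℝ) := by rw [real_inner_self_eq_norm_sq, hu]; norm_num
  have coord : ∀ s z, inner ℝ u (s • u + J z) = s := fun s z => by
    rw [inner_add_right, inner_smul_right, hJu, huu]; ring
  have bound : ∀ {z w}, z ∈ E → w ∈ E → inner ℝ u z - inner ℝ u w ≤ D := by
    intro z w hz hw
    rw [← inner_sub_right]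
    calc inner ℝ u (z - w) ≤ ‖u‖ * ‖z - w‖ := real_inner_le_norm _ _
      _ = dist z w := by rw [hu, one_mul, dist_eq_norm]
      _ ≤ D := Metric.dist_le_diam_of_mem hEc.isBounded hz hw
  have hle : t ≤ t₀ + D := by
    have := bound hy hx
    rw [coord, coord] at this
    linarith
  have hge : t₀ ≤ t := by
    have := bound hxu' hy
    rw [coord, coord] at this
    linarith
  set V := volume {y : En n | t • u + J y ∈ E} with hV
  have left : ENNReal.ofReal ((t - t₀) / (n + 1)) * V
      ≤ ∫⁻ s in Ioc t₀ t, volume {y : En n | s • u + J y ∈ E} := by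
    rcases hge.eq_or_lt with h | h
    · simp [h]
    rw [← lintegral_pow_rising h, ← lintegral_mul_const _ (by fun_prop)]
    refine setLIntegral_mono' measurableSet_Ioc fun s hs => ?_
    have hpos : 0 < t - t₀ := sub_pos.2 h
    have := volume_slice_cone_le hE hx (t := t) (c := (s - t₀) / (t - t₀))
      (div_nonneg (sub_nonneg.2 hs.1.le) hpos.le) ((div_le_one hpos).2 (by linarith [hs.2]))
    rwa [div_mul_cancel₀ _ hpos.ne', add_sub_cancel] at this
  have right : ENNReal.ofReal ((t₀ + D - t) / (n + 1)) * V
      ≤ ∫⁻ s in Ioc t (t₀ + D), volume {y : En n | s • u + J y ∈ E} := by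
    rcases hle.eq_or_lt with h | h
    · simp [h]
    rw [← lintegral_pow_falling h, ← lintegral_mul_const _ (by fun_prop)]
    refine setLIntegral_mono' measurableSet_Ioc fun s hs => ?_
    have hpos : 0 < t₀ + D - t := sub_pos.2 h
    have := volume_slice_cone_le hE hxu' (t := t) (c := (t₀ + D - s) / (t₀ + D - t))
      (div_nonneg (sub_nonneg.2 hs.2) hpos.le) ((div_le_one hpos).2 (by linarith [hs.1]))
    have e : t₀ + D + (t₀ + D - s) / (t₀ + D - t) * (t - (t₀ + D)) = s := by
      field_simp
      ring
    rwa [e] at this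
  calc ENNReal.ofReal (D / (n + 1)) * V
      = ENNReal.ofReal ((t - t₀) / (n + 1)) * V + ENNReal.ofReal ((t₀ + D - t) / (n + 1)) * V := by
        rw [← add_mul, ← ENNReal.ofReal_add (div_nonneg (by linarith) (by positivity))
          (div_nonneg (by linarith) (by positivity))]
        congr 2
        ring
    _ ≤ _ := add_le_add left right
    _ = ∫⁻ s in Ioc t₀ t ∪ Ioc t (t₀ + D), volume {y : En n | s • u + J y ∈ E} := by
        rw [lintegral_union measurableSet_Ioc]
        exact Set.disjoint_left.2 fun s hs hs' => absurd hs.2 (not_le.2 hs'.1)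
    _ ≤ ∫⁻ s, volume {y : En n | s • u + J y ∈ E} := setLIntegral_le_lintegral _ _
    _ = volume E := (volume_eq_lintegral_slice hJ hEc.isClosed.measurableSet).symm

/-- Thickening a compact set whose slices are no larger than a ball of radius `r` enlarges its
volume at least as much as for a cylinder of radius `r`. -/
theorem le_volume_thickening {n : ℕ} {u : En (n + 1)} {J : En n →ₗᵢ[ℝ] En (n + 1)}
    (hJ : MeasurePreserving (fun p : ℝ × En n => p.1 • u + J p.2))
    {K : Set (En (n + 1))} (hK : IsCompact K) {r ρ : ℝ} (hr : 0 < r) (hρ : 0 < ρ)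
    (hslice : ∀ t : ℝ, volume {y : En n | t • u + J y ∈ K} ≤ volume (Metric.ball (0 : En n) r)) :
    ENNReal.ofReal ((1 + ρ / r) ^ n) * volume K ≤ volume (Metric.thickening ρ K) := by
  have hσ : 0 < ρ / r := div_pos hρ hr
  set σ := ρ / r with hσd
  have hKm : MeasurableSet K := hK.isClosed.measurableSet
  have hTm : MeasurableSet (Metric.thickening ρ K) := Metric.isOpen_thickening.measurableSet
  have hcont : ∀ t : ℝ, Continuous fun y : En n => t • u + J y := fun t =>
    continuous_const.add J.continuous
  rw [volume_eq_lintegral_slice hJ hKm, volume_eq_lintegral_slice hJ hTm]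
  rw [← lintegral_const_mul' _ _ ENNReal.ofReal_ne_top]
  refine lintegral_mono fun t => ?_
  set A := {y : En n | t • u + J y ∈ K} with hA
  set S := {y : En n | t • u + J y ∈ Metric.thickening ρ K} with hS
  have hAm : MeasurableSet A := (hcont t).measurable hKm
  have hSm : MeasurableSet S := (hcont t).measurable hTm
  have hAb : Bornology.IsBounded A := by
    obtain ⟨R, hR⟩ := hK.isBounded.exists_norm_le
    refine isBounded_iff_forall_norm_le.2 ⟨R + ‖t • u‖, fun y hy => ?_⟩
    have h1 := hR _ hy
    have h2 : ‖J y‖ ≤ ‖t • u + J y‖ + ‖t • u‖ := by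
      simpa using norm_sub_le (t • u + J y) (t • u)
    rw [J.norm_map] at h2
    linarith
  have hs1 : (0 : ℝ) < 1 + σ := by positivity
  have hBM := brunn_minkowski (n := n) (a := (1 + σ)⁻¹) (b := σ / (1 + σ)) (by positivity)
    (by positivity) (by field_simp) hAm (Metric.isOpen_ball (x := (0 : En n)) (ε := r)).measurableSet
    (C := (fun z => (1 + σ) • z) ⁻¹' S) ((measurable_const_smul (1 + σ)) hSm) hAb
    Metric.isBounded_ball (by
      intro y hy z hz
      have hz' : ‖z‖ < r := by simpa using hz
      have e : (1 + σ) • ((1 + σ)⁻¹ • y + (σ / (1 + σ)) • z) = y + σ • z := by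
        rw [smul_add, smul_smul, smul_smul, mul_inv_cancel₀ hs1.ne', one_smul,
          mul_div_cancel₀ _ hs1.ne']
      simp only [mem_preimage, e]
      refine Metric.mem_thickening_iff.2 ⟨_, hy, ?_⟩
      rw [dist_eq_norm, map_add, ← add_assoc, add_sub_cancel_left, J.norm_map, norm_smul,
        Real.norm_of_nonneg hσ.le]
      calc σ * ‖z‖ < σ * r := by gcongr
        _ = ρ := div_mul_cancel₀ _ hr.ne')
  rw [Measure.addHaar_preimage_smul _ hs1.ne', finrank_euclideanSpace_fin,
    abs_of_pos (by positivity)] at hBM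
  have hAA : volume A ≤ volume A ^ (1 + σ)⁻¹ * volume (Metric.ball (0 : En n) r) ^ (σ / (1 + σ)) := by
    calc volume A = volume A ^ (1 + σ)⁻¹ * volume A ^ (σ / (1 + σ)) := by
          rw [← ENNReal.rpow_add_of_nonneg _ _ (by positivity) (by positivity)]
          have : (1 + σ)⁻¹ + σ / (1 + σ) = 1 := by field_simp
          rw [this, ENNReal.rpow_one]
      _ ≤ _ := by exact mul_le_mul_right (ENNReal.rpow_le_rpow (hslice t) (by positivity)) _
  calc ENNReal.ofReal ((1 + σ) ^ n) * volume A
      ≤ ENNReal.ofReal ((1 + σ) ^ n) * (ENNReal.ofReal (((1 + σ) ^ n)⁻¹) * volume S) := by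
        gcongr; exact hAA.trans hBM
    _ = volume S := by
        rw [← mul_assoc, ← ENNReal.ofReal_mul (by positivity), mul_inv_cancel₀ (by positivity),
          ENNReal.ofReal_one, one_mul]

section ConvexProjection

variable {V : Type*} [NormedAddCommGroup V] [InnerProductSpace ℝ V]

theorem exists_convex_projection {K : Set V} (hne : K.Nonempty) (hK : IsComplete K)
    (hconv : Convex ℝ K) :
    ∃ π : V → V, (∀ x, π x ∈ K) ∧ ∀ x, ∀ w ∈ K, inner ℝ (x - π x) (w - π x) ≤ 0 := by
  choose π hπK hπ using exists_norm_eq_iInf_of_complete_convex hne hK hconv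
  exact ⟨π, hπK, fun x => (norm_eq_iInf_iff_real_inner_le_zero hconv (hπK x)).1 (hπ x)⟩

/-- The nearest-point retraction onto the closed unit ball. -/
def unitClip (u : V) : V := (max 1 ‖u‖)⁻¹ • u

theorem norm_unitClip_le (u : V) : ‖unitClip u‖ ≤ 1 := by
  have h : 0 < max 1 ‖u‖ := lt_max_of_lt_left one_pos
  rw [unitClip, norm_smul, norm_inv, Real.norm_of_nonneg h.le, inv_mul_le_iff₀ h, mul_one]
  exact le_max_right _ _

theorem unitClip_of_norm_le {u : V} (hu : ‖u‖ ≤ 1) : unitClip u = u := by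
  simp [unitClip, max_eq_left hu]

theorem inner_sub_unitClip_le_zero (u : V) {w : V} (hw : ‖w‖ ≤ 1) :
    inner ℝ (u - unitClip u) (w - unitClip u) ≤ 0 := by
  rcases le_or_gt ‖u‖ 1 with hu | hu
  · simp [unitClip_of_norm_le hu]
  · have hpos : 0 < ‖u‖ := one_pos.trans hu
    have e : unitClip u = ‖u‖⁻¹ • u := by rw [unitClip, max_eq_right hu.le]
    have e1 : u - unitClip u = (1 - ‖u‖⁻¹) • u := by rw [e]; module
    have h2 : inner ℝ u (w - unitClip u) ≤ 0 := by
      rw [inner_sub_right, e, inner_smul_right, real_inner_self_eq_norm_sq]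
      have : inner ℝ u w ≤ ‖u‖ * ‖w‖ := real_inner_le_norm _ _
      have h3 : ‖u‖⁻¹ * ‖u‖ ^ 2 = ‖u‖ := by field_simp
      nlinarith
    rw [e1, real_inner_smul_left]
    exact mul_nonpos_of_nonneg_of_nonpos (sub_nonneg.2 (inv_le_one_of_one_le₀ hu.le)) h2

theorem norm_sub_sq_le_inner_of_variational {x y p q : V} (h₁ : inner ℝ (x - p) (q - p) ≤ 0)
    (h₂ : inner ℝ (y - q) (p - q) ≤ 0) : ‖p - q‖ ^ 2 ≤ inner ℝ (p - q) (x - y) := by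
  rw [← real_inner_self_eq_norm_sq]
  have e : inner ℝ (p - q) (x - y) - inner ℝ (p - q) (p - q)
      = -(inner ℝ (x - p) (q - p)) - inner ℝ (y - q) (p - q) := by
    simp only [inner_sub_left, inner_sub_right, real_inner_comm]
    ring
  linarith

theorem norm_unitClip_sub_sq_le (u v : V) :
    ‖unitClip u - unitClip v‖ ^ 2 ≤ inner ℝ (unitClip u - unitClip v) (u - v) :=
  norm_sub_sq_le_inner_of_variational (inner_sub_unitClip_le_zero u (norm_unitClip_le v))
    (inner_sub_unitClip_le_zero v (norm_unitClip_le u))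

end ConvexProjection

theorem inner_fderiv_nonneg_of_monotone {V : Type*} [NormedAddCommGroup V] [InnerProductSpace ℝ V]
    {φ : V → V} (hmono : ∀ x y, 0 ≤ inner ℝ (φ x - φ y) (x - y)) {x : V}
    (hx : DifferentiableAt ℝ φ x) (v : V) : 0 ≤ inner ℝ v (fderiv ℝ φ x v) := by
  have h1 : HasDerivAt (fun t : ℝ => φ (x + t • v)) (fderiv ℝ φ x v) 0 :=
    hx.hasFDerivAt.hasLineDerivAt v
  have h2 := h1.tendsto_slope_zero_right
  have h3 : Filter.Tendsto (fun t : ℝ => inner ℝ v (t⁻¹ • (φ (x + (0 + t) • v) - φ (x + (0 : ℝ) • v))))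
      (nhdsWithin 0 (Ioi 0)) (nhds (inner ℝ v (fderiv ℝ φ x v))) :=
    Filter.Tendsto.inner tendsto_const_nhds h2
  refine ge_of_tendsto h3 ?_
  filter_upwards [self_mem_nhdsWithin] with t ht
  have ht' : (0 : ℝ) < t := ht
  have h4 := hmono (x + t • v) x
  rw [add_sub_cancel_left, inner_smul_right, real_inner_comm] at h4
  rw [zero_add, zero_smul, add_zero, inner_smul_right]
  exact mul_nonneg (inv_nonneg.2 ht'.le) (nonneg_of_mul_nonneg_right h4 ht')

theorem divg_eq_sum_inner {N : ℕ} (φ : En N → En N) (x : En N)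
    (b : OrthonormalBasis (Fin N) ℝ (En N)) :
    divg φ x = ∑ i, inner ℝ (b i) (fderiv ℝ φ x (b i)) := by
  have h1 := LinearMap.trace_eq_sum_inner (fderiv ℝ φ x : En N →ₗ[ℝ] En N) b
  have h2 := LinearMap.trace_eq_sum_inner (fderiv ℝ φ x : En N →ₗ[ℝ] En N)
    (EuclideanSpace.basisFun (Fin N) ℝ)
  rw [h1] at h2
  simp only [ContinuousLinearMap.coe_coe] at h2
  rw [h2, divg]
  refine Finset.sum_congr rfl fun i _ => ?_
  rw [EuclideanSpace.basisFun_apply, EuclideanSpace.inner_single_left]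
  simp

/-- The gradient of a smoothed distance to a compact convex set `K`: a Lipschitz field of norm at
most one, with nonnegative divergence, which is at least `ρ⁻¹` in the `ρ`-collar of `K`. -/
theorem exists_collar_field {n : ℕ} {K : Set (En (n + 1))} (hne : K.Nonempty) (hK : IsCompact K)
    (hconv : Convex ℝ K) {ρ : ℝ} (hρ : 0 < ρ) :
    ∃ φ : En (n + 1) → En (n + 1), ∃ c, LipschitzWith c φ ∧ (∀ x, ‖φ x‖ ≤ 1) ∧
      (∀ x, DifferentiableAt ℝ φ x → 0 ≤ divg φ x) ∧
      ∀ x ∈ Metric.thickening ρ K \ K, DifferentiableAt ℝ φ x → ρ⁻¹ ≤ divg φ x := by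
  obtain ⟨π, hπK, hπ⟩ := exists_convex_projection hne hK.isComplete hconv
  have hρ' : 0 < ρ⁻¹ := inv_pos.2 hρ
  let φ : En (n + 1) → En (n + 1) := fun x => unitClip (ρ⁻¹ • (x - π x))
  have key : ∀ x y, ρ * ‖φ x - φ y‖ ^ 2 ≤ inner ℝ (φ x - φ y) (x - y) := by
    intro x y
    have h1 := norm_unitClip_sub_sq_le (ρ⁻¹ • (x - π x)) (ρ⁻¹ • (y - π y))
    have h2 : ∀ x y, 0 ≤ inner ℝ (φ x) (π x - π y) := by
      intro x y
      have := hπ x (π y) (hπK y)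
      rw [← neg_sub (π x) (π y), inner_neg_right, neg_nonpos] at this
      simp only [φ, unitClip, real_inner_smul_left]
      positivity
    have e : x - y = ρ • (ρ⁻¹ • (x - π x) - ρ⁻¹ • (y - π y)) + (π x - π y) := by
      rw [smul_sub, smul_smul, smul_smul, mul_inv_cancel₀ hρ.ne']
      module
    have h3 := h2 x y
    have h4 := h2 y x
    rw [← neg_sub (π x) (π y), inner_neg_right] at h4
    rw [e, inner_add_right, inner_smul_right, inner_sub_left (φ x) (φ y) (π x - π y)]
    have h5 := mul_le_mul_of_nonneg_left h1 hρ.le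
    simp only [φ] at *
    linarith
  have hmono : ∀ x y, 0 ≤ inner ℝ (φ x - φ y) (x - y) := fun x y =>
    le_trans (by positivity) (key x y)
  refine ⟨φ, (ρ⁻¹).toNNReal, LipschitzWith.of_dist_le_mul fun x y => ?_,
    fun x => norm_unitClip_le _, fun x hx => ?_, fun x hx hd => ?_⟩
  · rw [Real.coe_toNNReal _ hρ'.le, dist_eq_norm, dist_eq_norm]
    have h1 := (key x y).trans (real_inner_le_norm _ _)
    rcases (norm_nonneg (φ x - φ y)).eq_or_lt with h0 | h0
    · rw [← h0]; positivity
    · rw [le_inv_mul_iff₀ hρ]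
      refine le_of_mul_le_mul_left ?_ h0
      linarith
  · rw [divg_eq_sum_inner φ x (EuclideanSpace.basisFun _ ℝ)]
    exact Finset.sum_nonneg fun i _ => inner_fderiv_nonneg_of_monotone hmono hx _
  · obtain ⟨hxρ, hxK⟩ := hx
    set d := ‖x - π x‖ with hd_def
    have hd0 : 0 < d := by
      refine norm_pos_iff.2 fun h => hxK ?_
      rw [sub_eq_zero.1 h]
      exact hπK x
    have hdρ : d < ρ := by
      obtain ⟨w, hw, hxw⟩ := Metric.mem_thickening_iff.1 hxρ
      refine lt_of_le_of_lt ?_ hxw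
      rw [dist_eq_norm]
      have h1 := hπ x w hw
      have e : w - π x = (x - π x) - (x - w) := by abel
      rw [e, inner_sub_right, real_inner_self_eq_norm_sq] at h1
      have h2 := real_inner_le_norm (x - π x) (x - w)
      refine le_of_mul_le_mul_left ?_ hd0
      nlinarith
    set ν := d⁻¹ • (x - π x) with hν
    have hν1 : ‖ν‖ = 1 := by
      rw [hν, norm_smul, norm_inv, norm_norm, inv_mul_cancel₀ hd0.ne']
    have hdν : x - π x = d • ν := by rw [hν, smul_smul, mul_inv_cancel₀ hd0.ne', one_smul]
    have hline : ∀ t : ℝ, |t| < min d (ρ - d) → φ (x + t • ν) = ρ⁻¹ • ((d + t) • ν) := by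
      intro t ht
      have ht1 := abs_lt.1 (ht.trans_le (min_le_left _ _))
      have ht2 := abs_lt.1 (ht.trans_le (min_le_right _ _))
      have hπt : π (x + t • ν) = π x := by
        have h1 := hπ (x + t • ν) (π x) (hπK x)
        have h2 : inner ℝ (x + t • ν - π x) (π (x + t • ν) - π x) ≤ 0 := by
          have e : x + t • ν - π x = ((d + t) * d⁻¹) • (x - π x) := by
            rw [mul_smul, ← hν, add_sub_right_comm, add_smul, ← hdν]
          rw [e, real_inner_smul_left]
          exact mul_nonpos_of_nonneg_of_nonpos
            (mul_nonneg (by linarith) (inv_nonneg.2 hd0.le)) (hπ x _ (hπK _))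
        have h3 := norm_sub_sq_le_inner_of_variational h1 h2
        rw [sub_self, inner_zero_right] at h3
        exact sub_eq_zero.1 (norm_eq_zero.1 (pow_eq_zero_iff two_ne_zero |>.1
          (le_antisymm h3 (sq_nonneg _))))
      have e : x + t • ν - π (x + t • ν) = (d + t) • ν := by
        rw [hπt, add_sub_right_comm, hdν, add_smul]
      simp only [φ]
      rw [e]
      refine unitClip_of_norm_le ?_
      rw [norm_smul, norm_smul, hν1, mul_one, norm_inv, Real.norm_of_nonneg hρ.le,
        Real.norm_of_nonneg (by linarith), inv_mul_le_iff₀ hρ]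
      linarith
    have hderiv : fderiv ℝ φ x ν = ρ⁻¹ • ν := by
      have h1 : HasDerivAt (fun t : ℝ => φ (x + t • ν)) (fderiv ℝ φ x ν) 0 :=
        hd.hasFDerivAt.hasLineDerivAt ν
      have h2 : HasDerivAt (fun t : ℝ => ρ⁻¹ • ((d + t) • ν)) (ρ⁻¹ • ((1 : ℝ) • ν)) 0 :=
        (((hasDerivAt_id (0 : ℝ)).const_add d).smul_const ν).const_smul ρ⁻¹
      have h3 : (fun t : ℝ => φ (x + t • ν)) =ᶠ[nhds 0] fun t : ℝ => ρ⁻¹ • ((d + t) • ν) := by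
        have hm : 0 < min d (ρ - d) := lt_min hd0 (by linarith)
        filter_upwards [Metric.ball_mem_nhds (0 : ℝ) hm] with t ht
        exact hline t (by simpa using ht)
      rw [one_smul] at h2
      exact h1.unique (h2.congr_of_eventuallyEq h3)
    obtain ⟨b, hb⟩ := Orthonormal.exists_orthonormalBasis_extension_of_card_eq (𝕜 := ℝ)
      (E := En (n + 1)) (ι := Fin (n + 1)) (by simp) (v := fun _ => ν) (s := {0}) (by
        refine ⟨fun i => by simpa using hν1, fun i j hij => ?_⟩
        exact absurd (Subsingleton.elim i j) hij)
    have hb0 : b 0 = ν := hb 0 rfl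
    rw [divg_eq_sum_inner φ x b]
    calc ρ⁻¹ = inner ℝ (b 0) (fderiv ℝ φ x (b 0)) := by
          rw [hb0, hderiv, inner_smul_right, real_inner_self_eq_norm_sq, hν1]; ring
      _ ≤ _ := Finset.single_le_sum (f := fun i => inner ℝ (b i) (fderiv ℝ φ x (b i)))
          (fun i _ => inner_fderiv_nonneg_of_monotone hmono hd _) (Finset.mem_univ 0)

/-- The divergence of a linear map, as a continuous linear functional. -/
def divFunctional (N : ℕ) : (En N →L[ℝ] En N) →L[ℝ] ℝ :=
  ∑ i, (EuclideanSpace.proj i : En N →L[ℝ] ℝ).comp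
    (ContinuousLinearMap.apply ℝ (En N) (EuclideanSpace.single i (1 : ℝ)))

theorem divFunctional_apply {N : ℕ} (T : En N →L[ℝ] En N) :
    divFunctional N T = ∑ i, T (EuclideanSpace.single i (1 : ℝ)) i := by
  simp [divFunctional]

theorem divg_eq_divFunctional {N : ℕ} (φ : En N → En N) (x : En N) :
    divg φ x = divFunctional N (fderiv ℝ φ x) := (divFunctional_apply _).symm

theorem continuous_divg {N : ℕ} {φ : En N → En N} (hφ : ContDiff ℝ 1 φ) : Continuous (divg φ) := by
  have : divg φ = fun x => divFunctional N (fderiv ℝ φ x) := funext (divg_eq_divFunctional φ)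
  rw [this]
  exact (divFunctional N).continuous.comp (hφ.continuous_fderiv one_ne_zero)

open scoped Convolution in
theorem hasFDerivAt_convolution_of_lipschitz {N : ℕ} {k : En N → ℝ} (hk : Continuous k)
    (hkc : HasCompactSupport k) {φ : En N → En N} {C : NNReal} (hφ : LipschitzWith C φ) (x : En N) :
    Integrable (fun y => k y • fderiv ℝ φ (x - y)) ∧
    HasFDerivAt (fun x => ∫ y, k y • φ (x - y)) (∫ y, k y • fderiv ℝ φ (x - y)) x := by
  have hki : Integrable k := hk.integrable_of_hasCompactSupport hkc
  have hcont : ∀ z, Continuous fun y => k y • φ (z - y) := fun z =>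
    hk.smul (hφ.continuous.comp (continuous_const.sub continuous_id))
  have hdiff : ∀ᵐ y, DifferentiableAt ℝ φ (x - y) :=
    ((volume : Measure (En N)).measurePreserving_sub_left x).quasiMeasurePreserving.ae
      hφ.ae_differentiableAt
  refine hasFDerivAt_integral_of_dominated_loc_of_lip (bound := fun y => C * |k y|)
    (F := fun x y => k y • φ (x - y)) Filter.univ_mem ?_ ?_ ?_ ?_ (hki.abs.const_mul _) ?_
  · exact .of_forall fun z => (hcont z).aestronglyMeasurable
  · exact (hcont x).integrable_of_hasCompactSupport hkc.smul_right
  · exact hk.aestronglyMeasurable.smul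
      ((measurable_fderiv ℝ φ).comp (measurable_const_sub x)).aestronglyMeasurable
  · refine .of_forall fun y => LipschitzOnWith.of_dist_le_mul fun a _ b _ => ?_
    have h1 := hφ.dist_le_mul (a - y) (b - y)
    rw [dist_sub_right] at h1
    have e : ((Real.nnabs (C * |k y|) : NNReal) : ℝ) = C * |k y| := by
      rw [Real.coe_nnabs, abs_of_nonneg (by positivity)]
    rw [dist_smul₀, e, Real.norm_eq_abs]
    nlinarith [abs_nonneg (k y)]
  · filter_upwards [hdiff] with y hy
    have h1 : HasFDerivAt (fun z => φ (z - y)) (fderiv ℝ φ (x - y)) x :=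
      (hasFDerivAt_comp_sub y).2 hy.hasFDerivAt
    exact h1.const_smul (k y)

open scoped Convolution in
theorem exists_mem_perSet_ge {N : ℕ} {E A : Set (En N)} (hE : IsCompact E)
    (hA : MeasurableSet A) {ε : ℝ} (hε : 0 < ε) (hAE : ∀ x ∈ A, Metric.ball x ε ⊆ E)
    {φ : En N → En N} {C : NNReal} (hφ : LipschitzWith C φ) (hφ1 : ∀ x, ‖φ x‖ ≤ 1) {c : ℝ}
    (hdiv : ∀ x, DifferentiableAt ℝ φ x → 0 ≤ divg φ x)
    (hdivA : ∀ x ∈ A, DifferentiableAt ℝ φ x → c ≤ divg φ x) :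
    ∃ p ∈ perSet E, c * volume.real A ≤ p := by
  let κ : ContDiffBump (0 : En N) := ⟨ε / 2, ε, half_pos hε, half_lt_self hε⟩
  set k : En N → ℝ := κ.normed volume with hk_def
  have hksm : ContDiff ℝ 1 k := κ.contDiff_normed
  have hk : Continuous k := hksm.continuous
  have hkc : HasCompactSupport k := κ.hasCompactSupport_normed
  have hk0 : ∀ y, 0 ≤ k y := κ.nonneg_normed
  have hk1 : ∫ y, k y = 1 := κ.integral_normed
  have hkb : ∀ y, k y ≠ 0 → ‖y‖ < ε := by
    intro y hy
    have : y ∈ Function.support k := hy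
    rw [hk_def, κ.support_normed_eq] at this
    simpa using this
  have hki : Integrable k := hk.integrable_of_hasCompactSupport hkc
  set ψ : En N → En N := fun x => ∫ y, k y • φ (x - y) with hψ_def
  have hψsm : ContDiff ℝ 1 ψ :=
    hkc.contDiff_convolution_left (ContinuousLinearMap.lsmul ℝ ℝ) (n := 1) hksm
      (hφ.continuous.locallyIntegrable (μ := volume))
  have hψ1 : ∀ x, ‖ψ x‖ ≤ 1 := by
    intro x
    rw [← hk1]
    refine norm_integral_le_of_norm_le hki (.of_forall fun y => ?_)
    rw [norm_smul, Real.norm_of_nonneg (hk0 y)]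
    exact mul_le_of_le_one_right (hk0 y) (hφ1 _)
  have hAfin : volume A ≠ ∞ := by
    refine ne_top_of_le_ne_top hE.measure_lt_top.ne (measure_mono fun x hx => ?_)
    exact hAE x hx (Metric.mem_ball_self hε)
  have hAi : Integrable (A.indicator fun _ => c) := by
    rw [integrable_indicator_iff hA]
    exact integrableOn_const hAfin
  have hconv_int : Integrable (k ⋆[ContinuousLinearMap.mul ℝ ℝ, volume] A.indicator fun _ => c) :=
    hki.integrable_convolution _ hAi
  have hdivψ : ∀ x, (k ⋆[ContinuousLinearMap.mul ℝ ℝ, volume] A.indicator fun _ => c) x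
      ≤ divg ψ x := by
    intro x
    obtain ⟨hinteg, hder⟩ := hasFDerivAt_convolution_of_lipschitz hk hkc hφ x
    have hdiff : ∀ᵐ y, DifferentiableAt ℝ φ (x - y) :=
      ((volume : Measure (En N)).measurePreserving_sub_left x).quasiMeasurePreserving.ae
        hφ.ae_differentiableAt
    rw [divg_eq_divFunctional, hder.fderiv, ← ContinuousLinearMap.integral_comp_comm _ hinteg,
      convolution_def]
    refine integral_mono_ae ?_ ((divFunctional N).integrable_comp hinteg) ?_
    · refine Integrable.mono' (hki.mul_const |c|) ?_ (.of_forall fun y => ?_)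
      · exact hk.aestronglyMeasurable.mul
          (((measurable_const.indicator hA).comp (measurable_const_sub x)).aestronglyMeasurable)
      · rw [ContinuousLinearMap.mul_apply', norm_mul, Real.norm_of_nonneg (hk0 y)]
        refine mul_le_mul_of_nonneg_left ?_ (hk0 y)
        by_cases hy : x - y ∈ A <;> simp [hy]
    · filter_upwards [hdiff] with y hy
      rw [ContinuousLinearMap.mul_apply', map_smul, smul_eq_mul, ← divg_eq_divFunctional]
      refine mul_le_mul_of_nonneg_left ?_ (hk0 y)
      by_cases hyA : x - y ∈ A
      · simpa [hyA] using hdivA _ hyA hy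
      · simpa [hyA] using hdiv _ hy
  obtain ⟨R, hR0, hR⟩ := hE.isBounded.exists_pos_norm_lt
  let ζ : ContDiffBump (0 : En N) := ⟨R, R + 1, hR0, lt_add_one R⟩
  have heq : ∀ x ∈ E, divg (fun x => ζ x • ψ x) x = divg ψ x := by
    intro x hx
    have hev : (fun x => ζ x • ψ x) =ᶠ[nhds x] ψ := by
      have hxR : x ∈ Metric.ball (0 : En N) R := by simpa using hR x hx
      filter_upwards [Metric.isOpen_ball.mem_nhds hxR] with y hy
      rw [ζ.one_of_mem_closedBall (Metric.ball_subset_closedBall hy), one_smul]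
    rw [divg, divg, hev.fderiv_eq]
  refine ⟨∫ x in E, divg (fun x => ζ x • ψ x) x, ⟨_, ζ.contDiff.smul hψsm,
    ζ.hasCompactSupport.smul_right, fun x => ?_, rfl⟩, ?_⟩
  · change ‖ζ x • ψ x‖ ≤ 1
    rw [norm_smul, Real.norm_of_nonneg ζ.nonneg]
    exact mul_le_one₀ ζ.le_one (norm_nonneg _) (hψ1 x)
  · rw [setIntegral_congr_fun hE.isClosed.measurableSet heq]
    calc c * volume.real A
        = ∫ x, (k ⋆[ContinuousLinearMap.mul ℝ ℝ, volume] A.indicator fun _ => c) x := by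
          rw [integral_convolution _ hki hAi, hk1, integral_indicator hA, setIntegral_const]
          simp [mul_comm]
      _ = ∫ x in E, (k ⋆[ContinuousLinearMap.mul ℝ ℝ, volume] A.indicator fun _ => c) x := by
          refine (setIntegral_eq_integral_of_forall_compl_eq_zero fun x hx => ?_).symm
          rw [convolution_def]
          refine integral_eq_zero_of_ae (.of_forall fun y => ?_)
          by_cases hky : k y = 0
          · simp [hky]
          · have : x - y ∉ A := fun h => hx (hAE _ h (by
              rw [Metric.mem_ball, dist_eq_norm]
              simpa using hkb y hky))
            simp [this]
      _ ≤ ∫ x in E, divg ψ x :=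
          setIntegral_mono hconv_int.integrableOn
            ((continuous_divg hψsm).continuousOn.integrableOn_compact hE) hdivψ

/-- A scalar field bounded by one has uniformly bounded integrated directional derivatives over a
set which is almost invariant under small translations. -/
theorem setIntegral_fderiv_le_of_translate {N : ℕ} {E : Set (En N)} (hE : IsCompact E) {v : En N}
    {δ M : ℝ} (hδ : 0 < δ)
    (htrans : ∀ h ∈ Ioo 0 δ, ∃ S, IsCompact S ∧ E ⊆ S ∧ (∀ x ∈ E, x + h • v ∈ S) ∧
      volume.real S - volume.real E ≤ M * h)
    {g : En N → ℝ} (hg : ContDiff ℝ 1 g) (hgc : HasCompactSupport g) (hg1 : ∀ x, |g x| ≤ 1) :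
    ∫ x in E, fderiv ℝ g x v ≤ 2 * M := by
  have hgcont := hg.continuous
  obtain ⟨C, hC⟩ := hg.lipschitzWith_of_hasCompactSupport hgc one_ne_zero
  have hder : HasDerivAt (fun h : ℝ => ∫ x in E, g (x + h • v)) (∫ x in E, fderiv ℝ g x v) 0 := by
    refine (hasDerivAt_integral_of_dominated_loc_of_lip (bound := fun _ => C * ‖v‖)
      (F := fun (h : ℝ) x => g (x + h • v)) Filter.univ_mem ?_ ?_ ?_ ?_ ?_ ?_).2
    · exact .of_forall fun h =>
        (hgcont.comp (continuous_id.add continuous_const)).aestronglyMeasurable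
    · simpa [IntegrableOn] using hgcont.continuousOn.integrableOn_compact (μ := volume) hE
    · exact ((hg.continuous_fderiv one_ne_zero).clm_apply continuous_const).aestronglyMeasurable
    · refine .of_forall fun x => LipschitzOnWith.of_dist_le_mul fun a _ b _ => ?_
      have h1 := hC.dist_le_mul (x + a • v) (x + b • v)
      rw [dist_add_left, dist_eq_norm (a • v), ← sub_smul, norm_smul, ← dist_eq_norm] at h1
      rw [Real.coe_nnabs, abs_of_nonneg (by positivity)]
      linarith
    · exact integrableOn_const hE.measure_lt_top.ne
    · exact .of_forall fun x =>
        (hg.differentiable one_ne_zero x).hasFDerivAt.hasLineDerivAt v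
  have hlim := hder.tendsto_slope_zero_right
  refine le_of_tendsto hlim ?_
  filter_upwards [Ioo_mem_nhdsGT hδ] with h hh
  obtain ⟨S, hS, hES, hvS, hvol⟩ := htrans h hh
  have hEm := hE.isClosed.measurableSet
  have hSm := hS.isClosed.measurableSet
  have hinteg : ∀ {T : Set (En N)}, IsCompact T → IntegrableOn (fun x => 1 + g x) T := fun hT =>
    (continuous_const.add hgcont).continuousOn.integrableOn_compact hT
  have hnn : ∀ x, 0 ≤ 1 + g x := fun x => by linarith [(abs_le.1 (hg1 x)).1]
  have hET : IsCompact ((fun x => x + h • v) '' E) := hE.image (by fun_prop)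
  have e1 : ∫ x in E, (1 + g (x + h • v)) = ∫ x in (fun x => x + h • v) '' E, (1 + g x) :=
    ((measurePreserving_add_right volume (h • v)).setIntegral_image_emb
      (MeasurableEquiv.addRight (h • v)).measurableEmbedding (fun x => 1 + g x) E).symm
  have e2 : ∫ x in (fun x => x + h • v) '' E, (1 + g x) ≤ ∫ x in S, (1 + g x) :=
    setIntegral_mono_set (hinteg hS) (.of_forall hnn)
      (LE.le.eventuallyLE (image_subset_iff.2 hvS))
  have e3 : ∫ x in S, (1 + g x) = (∫ x in S \ E, (1 + g x)) + ∫ x in E, (1 + g x) := by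
    rw [← setIntegral_union disjoint_sdiff_left hEm ((hinteg hS).mono_set sdiff_subset) (hinteg hE),
      sdiff_union_of_subset hES]
  have e4 : ∫ x in S \ E, (1 + g x) ≤ 2 * (volume.real S - volume.real E) := by
    rw [← measureReal_sdiff hES hEm hS.measure_lt_top.ne]
    have hfin : volume (S \ E) ≠ ∞ :=
      ne_top_of_le_ne_top hS.measure_lt_top.ne (measure_mono sdiff_subset)
    calc ∫ x in S \ E, (1 + g x) ≤ ∫ x in S \ E, (2 : ℝ) :=
          setIntegral_mono ((hinteg hS).mono_set sdiff_subset) (integrableOn_const hfin)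
            fun x => by linarith [(abs_le.1 (hg1 x)).2]
      _ = 2 * volume.real (S \ E) := by rw [setIntegral_const, smul_eq_mul, mul_comm]
  have hgi : ∀ a : ℝ, IntegrableOn (fun x => g (x + a • v)) E := fun a =>
    (hgcont.comp (continuous_id.add continuous_const)).continuousOn.integrableOn_compact hE
  have e5 : ∫ x in E, (1 + g (x + h • v)) = (∫ x in E, (1 : ℝ)) + ∫ x in E, g (x + h • v) :=
    integral_add (integrableOn_const hE.measure_lt_top.ne) (hgi h)
  have e6 : ∫ x in E, (1 + g x) = (∫ x in E, (1 : ℝ)) + ∫ x in E, g x :=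
    integral_add (integrableOn_const hE.measure_lt_top.ne) (by simpa [IntegrableOn] using hgi 0)
  simp only [zero_add, zero_smul, add_zero, smul_eq_mul]
  rw [inv_mul_le_iff₀ hh.1]
  linarith

theorem hasFinitePerimeter_of_convex {N : ℕ} {E : Set (En N)} (hE : IsCompact E)
    (hconv : Convex ℝ E) {x₀ : En N} {ρ : ℝ} (hρ : 0 < ρ) (hball : Metric.closedBall x₀ ρ ⊆ E) :
    HasFinitePerimeter E := by
  set M : ℝ := (N * 2 ^ N / ρ) * volume.real E with hM
  refine ⟨∑ _i : Fin N, 2 * M, ?_⟩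
  rintro p ⟨φ, hφ, hφc, hφ1, rfl⟩
  have hcomp : ∀ i x v, fderiv ℝ (fun x => φ x i) x v = fderiv ℝ φ x v i := by
    intro i x v
    have h1 : HasFDerivAt (fun x => φ x i)
        ((EuclideanSpace.proj i : En N →L[ℝ] ℝ).comp (fderiv ℝ φ x)) x :=
      (EuclideanSpace.proj i : En N →L[ℝ] ℝ).hasFDerivAt.comp x
        (hφ.differentiable one_ne_zero x).hasFDerivAt
    rw [h1.fderiv]
    rfl
  have hsm : ∀ i, ContDiff ℝ 1 fun x => φ x i := fun i =>
    (EuclideanSpace.proj i : En N →L[ℝ] ℝ).contDiff.comp hφ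
  simp only [divg]
  rw [integral_finsetSum]
  · refine Finset.sum_le_sum fun i _ => ?_
    simp only [← hcomp]
    refine setIntegral_fderiv_le_of_translate hE hρ ?_ (hsm i)
      (hφc.comp_left (g := fun y : En N => y i) rfl)
      fun x => (PiLp.norm_apply_le (φ x) i).trans (hφ1 x)
    intro h hh
    have hpos : 0 < 1 + h / ρ := by have := div_pos hh.1 hρ; linarith
    have hx₀ : x₀ ∈ E := hball (Metric.mem_closedBall_self hρ.le)
    refine ⟨AffineMap.homothety x₀ (1 + h / ρ) '' E, hE.image (AffineMap.homothety_continuous _ _),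
      fun x hx => ?_, fun x hx => ?_, ?_⟩
    · have hy := hconv hx₀ hx (a := 1 - (1 + h / ρ)⁻¹) (b := (1 + h / ρ)⁻¹)
        (sub_nonneg.2 (inv_le_one_of_one_le₀ (by have := div_pos hh.1 hρ; linarith)))
        (by positivity) (by ring)
      refine ⟨_, hy, ?_⟩
      simp only [AffineMap.homothety_apply, vsub_eq_sub, vadd_eq_add]
      have : (1 + h / ρ) • ((1 - (1 + h / ρ)⁻¹) • x₀ + (1 + h / ρ)⁻¹ • x - x₀)
          = ((1 + h / ρ) * (1 + h / ρ)⁻¹) • (x - x₀) := by module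
      rw [this, mul_inv_cancel₀ hpos.ne', one_smul, sub_add_cancel]
    · have hb : x₀ + ρ • EuclideanSpace.single i (1 : ℝ) ∈ E := hball (by
        rw [Metric.mem_closedBall, dist_eq_norm, add_sub_cancel_left, norm_smul]
        simp [abs_of_pos hρ])
      have hy := hconv hx hb (a := (1 + h / ρ)⁻¹) (b := (1 + h / ρ)⁻¹ * (h / ρ)) (by positivity)
        (by have := div_pos hh.1 hρ; positivity)
        (by rw [← mul_one_add, inv_mul_cancel₀ hpos.ne'])
      refine ⟨_, hy, ?_⟩
      simp only [AffineMap.homothety_apply, vsub_eq_sub, vadd_eq_add]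
      rw [smul_sub, smul_add, smul_smul, smul_smul, ← mul_assoc, mul_inv_cancel₀ hpos.ne', one_mul,
        one_smul, smul_add, smul_smul, div_mul_cancel₀ _ hρ.ne']
      module
    · rw [measureReal_def, Measure.addHaar_image_homothety, finrank_euclideanSpace_fin,
        ENNReal.toReal_mul, ENNReal.toReal_ofReal (abs_nonneg _), abs_of_pos (by positivity),
        ← measureReal_def]
      have hs1 : 1 + h / ρ ≤ 2 := by
        have := (div_le_one hρ).2 hh.2.le
        linarith
      have hpow : (1 + h / ρ) ^ N - 1 ≤ N * 2 ^ N * (h / ρ) := by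
        have h0 : 0 ≤ h / ρ := (div_pos hh.1 hρ).le
        have hg := mul_geom_sum (1 + h / ρ) N
        rw [← hg, add_sub_cancel_left, mul_comm]
        refine mul_le_mul_of_nonneg_right ?_ h0
        calc ∑ j ∈ Finset.range N, (1 + h / ρ) ^ j ≤ ∑ _j ∈ Finset.range N, (2 : ℝ) ^ N :=
              Finset.sum_le_sum fun j hj =>
                (pow_le_pow_left₀ hpos.le hs1 j).trans
                  (pow_le_pow_right₀ one_le_two (Finset.mem_range.1 hj).le)
          _ = N * 2 ^ N := by simp
      have := mul_le_mul_of_nonneg_right hpow (measureReal_nonneg (μ := volume) (s := E))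
      rw [hM]
      calc _ = ((1 + h / ρ) ^ N - 1) * volume.real E := by ring
        _ ≤ _ := this
        _ = _ := by ring
  · intro i _
    simp only [← hcomp]
    exact (((hsm i).continuous_fderiv one_ne_zero).clm_apply
      continuous_const).continuousOn.integrableOn_compact hE

theorem Convex.exists_closedBall_subset {N : ℕ} {E : Set (En N)} (hE : Convex ℝ E)
    (hvol : volume E ≠ 0) : ∃ x₀ : En N, ∃ c : ℝ, 0 < c ∧ Metric.closedBall x₀ c ⊆ E := by
  have hspan : affineSpan ℝ E = ⊤ := by
    by_contra h
    exact hvol (measure_mono_null (subset_affineSpan ℝ E) (Measure.addHaar_affineSubspace _ _ h))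
  obtain ⟨x₀, hx₀⟩ := hE.interior_nonempty_iff_affineSpan_eq_top.2 hspan
  obtain ⟨c, hc, hcE⟩ := Metric.nhds_basis_closedBall.mem_iff.1 (mem_interior_iff_mem_nhds.1 hx₀)
  exact ⟨x₀, c, hc, hcE⟩

theorem IsCompact.exists_dist_eq_diam {X : Type*} [PseudoMetricSpace X] {E : Set X}
    (hE : IsCompact E) (hne : E.Nonempty) : ∃ x ∈ E, ∃ y ∈ E, dist x y = Metric.diam E := by
  obtain ⟨⟨x, y⟩, ⟨hx, hy⟩, hmax⟩ :=
    (hE.prod hE).exists_isMaxOn (hne.prod hne) (f := fun p : X × X => dist p.1 p.2)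
      continuous_dist.continuousOn
  refine ⟨x, hx, y, hy, le_antisymm (Metric.dist_le_diam_of_mem hE.isBounded hx hy) ?_⟩
  exact Metric.diam_le_of_forall_dist_le dist_nonneg fun a ha b hb =>
    isMaxOn_iff.1 hmax (a, b) ⟨ha, hb⟩

theorem ball_subset_of_mem_thickening_homothety {N : ℕ} {E : Set (En N)} (hE : Convex ℝ E)
    {x₀ : En N} {c l ρ : ℝ} (hl0 : 0 < l) (hl1 : l < 1) (hρ : 2 * ρ = (1 - l) * c)
    (hball : Metric.closedBall x₀ c ⊆ E) {x : En N}
    (hx : x ∈ Metric.thickening ρ (AffineMap.homothety x₀ l '' E)) : Metric.ball x ρ ⊆ E := by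
  intro z hz
  obtain ⟨_, ⟨w, hw, rfl⟩, hxw⟩ := Metric.mem_thickening_iff.1 hx
  have hl : 0 < 1 - l := sub_pos.2 hl1
  set y := AffineMap.homothety x₀ l w with hy
  have hzy : ‖z - y‖ ≤ (1 - l) * c := by
    rw [← dist_eq_norm]
    have := dist_triangle z x y
    have := Metric.mem_ball.1 hz
    linarith
  have hb : x₀ + (1 - l)⁻¹ • (z - y) ∈ E := hball (by
    rw [Metric.mem_closedBall, dist_eq_norm, add_sub_cancel_left, norm_smul,
      Real.norm_of_nonneg (inv_nonneg.2 hl.le), inv_mul_le_iff₀ hl]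
    exact hzy)
  have := hE hw hb hl0.le hl.le (by ring)
  convert this using 1
  rw [smul_add, smul_smul, mul_inv_cancel₀ hl.ne', one_smul, hy, AffineMap.homothety_apply,
    vsub_eq_sub, vadd_eq_add]
  module

theorem perimeter_ge_of_volume_slice_le {n : ℕ} {u : En (n + 1)} {J : En n →ₗᵢ[ℝ] En (n + 1)}
    (hJ : MeasurePreserving (fun p : ℝ × En n => p.1 • u + J p.2))
    {E : Set (En (n + 1))} (hE : IsCompact E) (hconv : Convex ℝ E) (hvol : volume E ≠ 0)
    {r : ℝ} (hr : 0 < r)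
    (hslice : ∀ t : ℝ, volume {y : En n | t • u + J y ∈ E} ≤ volume (Metric.ball (0 : En n) r)) :
    n / r * volume.real E ≤ perimeter E := by
  obtain ⟨x₀, c, hc, hball⟩ := hconv.exists_closedBall_subset hvol
  have hx₀ : x₀ ∈ E := hball (Metric.mem_closedBall_self hc.le)
  have hbdd : BddAbove (perSet E) := hasFinitePerimeter_of_convex hE hconv hc hball
  have key : ∀ l ∈ Ioo (0 : ℝ) 1, l ^ (n + 1) * (n / r * volume.real E) ≤ perimeter E := by
    rintro l ⟨hl0, hl1⟩
    set K := AffineMap.homothety x₀ l '' E with hKdef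
    have hK : IsCompact K := hE.image (AffineMap.homothety_continuous _ _)
    have hKconv : Convex ℝ K := hconv.affine_image _
    have hKne : K.Nonempty := ⟨_, x₀, hx₀, rfl⟩
    have hKvol : volume.real K = l ^ (n + 1) * volume.real E := by
      rw [measureReal_def, Measure.addHaar_image_homothety, finrank_euclideanSpace_fin,
        ENNReal.toReal_mul, ENNReal.toReal_ofReal (abs_nonneg _), abs_of_pos (by positivity),
        ← measureReal_def]
    have hl : 0 < 1 - l := sub_pos.2 hl1
    obtain ⟨ρ, hρdef⟩ : ∃ ρ, 2 * ρ = (1 - l) * c := ⟨(1 - l) * c / 2, by ring⟩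
    have hρ : 0 < ρ := by nlinarith [mul_pos hl hc]
    have hTE : ∀ x ∈ Metric.thickening ρ K, Metric.ball x ρ ⊆ E := fun x hx =>
      ball_subset_of_mem_thickening_homothety hconv hl0 hl1 hρdef hball hx
    have hKT : K ⊆ Metric.thickening ρ K := Metric.self_subset_thickening hρ K
    have hT : Metric.thickening ρ K ⊆ E := fun x hx => hTE x hx (Metric.mem_ball_self hρ)
    have hTfin : volume (Metric.thickening ρ K) ≠ ∞ :=
      ne_top_of_le_ne_top hE.measure_lt_top.ne (measure_mono hT)
    have hthick := le_volume_thickening hJ hK hr hρ fun t =>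
      (measure_mono (preimage_mono (f := fun y => t • u + J y) (hKT.trans hT))).trans (hslice t)
    have hthick' : (1 + ρ / r) ^ n * volume.real K ≤ volume.real (Metric.thickening ρ K) := by
      have := ENNReal.toReal_mono hTfin hthick
      rwa [ENNReal.toReal_mul, ENNReal.toReal_ofReal (by positivity)] at this
    have hbern : 1 + n * (ρ / r) ≤ (1 + ρ / r) ^ n :=
      one_add_mul_le_pow (by have := div_pos hρ hr; linarith) n
    obtain ⟨φ, C, hφ, hφ1, hφ0, hφρ⟩ := exists_collar_field hKne hK hKconv hρ
    obtain ⟨p, hp, hpA⟩ := exists_mem_perSet_ge hE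
      (A := Metric.thickening ρ K \ K)
      (Metric.isOpen_thickening.measurableSet.diff hK.isClosed.measurableSet) hρ
      (fun x hx => hTE x hx.1) hφ hφ1 hφ0 hφρ
    refine le_trans ?_ (hpA.trans (le_csSup hbdd hp))
    rw [measureReal_sdiff hKT hK.isClosed.measurableSet hTfin, le_inv_mul_iff₀ hρ]
    have h1 := mul_le_mul_of_nonneg_right hbern (measureReal_nonneg (μ := volume) (s := K))
    calc ρ * (l ^ (n + 1) * (n / r * volume.real E))
        = n * (ρ / r) * volume.real K := by rw [hKvol]; ring
      _ ≤ _ := by linarith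
  have hlim : Filter.Tendsto (fun l : ℝ => l ^ (n + 1) * (n / r * volume.real E))
      (nhdsWithin 1 (Iio 1)) (nhds (n / r * volume.real E)) := by
    have : Continuous fun l : ℝ => l ^ (n + 1) * (n / r * volume.real E) := by fun_prop
    simpa using (this.tendsto 1).mono_left nhdsWithin_le_nhds
  exact le_of_tendsto hlim (by filter_upwards [Ioo_mem_nhdsLT zero_lt_one] with l hl using key l hl)

theorem omegaB_pos (N : ℕ) : 0 < omegaB N :=
  ENNReal.toReal_pos (Metric.measure_ball_pos _ _ one_pos).ne' measure_ball_lt_top.ne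

theorem volume_ball_eq_omegaB {n : ℕ} {r : ℝ} (hr : 0 < r) :
    volume (Metric.ball (0 : En n) r) = ENNReal.ofReal (r ^ n * omegaB n) := by
  rw [Measure.addHaar_ball_of_pos _ _ hr, finrank_euclideanSpace_fin, omegaB,
    ENNReal.ofReal_mul (by positivity), ENNReal.ofReal_toReal measure_ball_lt_top.ne]

/-- A unit-volume convex body in `ℝ^N` whose diameter exceeds `N𝒟`, where
`𝒟 = (2N/(N-1))^{N-1} ω_N^{(N-1)/N} / ω_{N-1}`, has perimeter at least `2Nω_N^{1/N}`,
i.e. isoperimetric deficit at least `1`. -/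
theorem convex_large_diameter_deficit {N : ℕ} (hN : 2 ≤ N) (E : Set (En N))
    (hconv : Convex ℝ E) (hcomp : IsCompact E) (hvol : volume E = 1)
    (hdiam : (N : ℝ) * ((2 * N / ((N : ℝ) - 1)) ^ (N - 1)
        * (omegaB N) ^ (((N : ℝ) - 1) / N) / omegaB (N - 1)) < Metric.diam E) :
    2 * N * (omegaB N) ^ ((1 : ℝ) / N) ≤ perimeter E := by
  obtain ⟨n, rfl⟩ : ∃ n, N = n + 1 := ⟨N - 1, by omega⟩
  have hn : (0 : ℝ) < n := by exact_mod_cast (by omega : 0 < n)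
  have hw := omegaB_pos (n + 1)
  have hw' := omegaB_pos n
  set b : ℝ := omegaB (n + 1) ^ ((1 : ℝ) / (n + 1 : ℕ)) with hb
  have hb0 : 0 < b := Real.rpow_pos_of_pos hw _
  have hbn : omegaB (n + 1) ^ ((((n + 1 : ℕ) : ℝ) - 1) / (n + 1 : ℕ)) = b ^ n := by
    rw [hb, ← Real.rpow_mul_natCast hw.le]
    congr 1
    push_cast
    ring
  rw [hbn] at hdiam
  push_cast at hdiam ⊢
  rw [add_sub_cancel_right] at hdiam
  set r : ℝ := n / (2 * (n + 1) * b) with hr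
  have hr0 : 0 < r := by positivity
  have hdiam' : ((n : ℝ) + 1) / (r ^ n * omegaB n) < Metric.diam E := by
    convert hdiam using 1
    rw [hr, div_pow, div_pow, mul_pow]
    field_simp
  have hD : 0 < Metric.diam E := lt_trans (by positivity) hdiam'
  have hne : E.Nonempty := nonempty_of_measure_ne_zero (μ := volume) (by simp [hvol])
  obtain ⟨y, hy, x, hx, hxy⟩ := hcomp.exists_dist_eq_diam hne
  set u : En (n + 1) := (Metric.diam E)⁻¹ • (y - x) with hu_def
  have hu : ‖u‖ = 1 := by
    rw [hu_def, norm_smul, Real.norm_of_nonneg (inv_nonneg.2 hD.le), ← dist_eq_norm, hxy,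
      inv_mul_cancel₀ hD.ne']
  have hxu : x + Metric.diam E • u ∈ E := by
    rwa [hu_def, smul_inv_smul₀ hD.ne', add_sub_cancel]
  obtain ⟨J, hJu, hJs, hJ⟩ := exists_measurePreserving_slicing hu
  have hslice : ∀ t : ℝ,
      volume {y : En n | t • u + J y ∈ E} ≤ volume (Metric.ball (0 : En n) r) := by
    intro t
    have h1 := volume_slice_le hu hJu hJs hJ hconv hcomp hx hxu t
    have hpos : 0 < Metric.diam E / (n + 1) := by positivity
    rw [hvol] at h1
    refine (ENNReal.le_inv_iff_mul_le.2 ((mul_comm _ _).trans_le h1)).trans ?_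
    rw [volume_ball_eq_omegaB hr0, ← ENNReal.ofReal_inv_of_pos hpos]
    refine ENNReal.ofReal_le_ofReal ?_
    rw [div_lt_iff₀ (by positivity)] at hdiam'
    rw [inv_div, div_le_iff₀ hD]
    linarith
  have hfinal := perimeter_ge_of_volume_slice_le hJ hcomp hconv (by simp [hvol]) hr0 hslice
  rw [measureReal_def, hvol, ENNReal.toReal_one, mul_one] at hfinal
  convert hfinal using 1
  rw [hr]
  field_simp
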